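/- A linear code whose dual distance exceeds m gives an orthogonal array of strength m (Delsarte's correspondence): let F be a finite field with |F| = d, let C be an F-subspace of F^N, and suppose every nonzero codeword of the dual code C⊥ has Hamming weight at least m+1 (where m ≤ N). Then the array whose rows are the codewords of C is an orthogonal array of strength m; that is, for every set T of m distinct coordinates and every assignment f : T → F, the number of codewords c ∈ C with c t = f t for all t ∈ T is exactly |C| / d^m. -/

import Mathlib

/-- The fibres of a surjective linear map between finite modules are equinumerous. -/
theorem LinearMap.card_fiber_mul_card_of_surjective {R M P : Type*} [Ring R] [AddCommGroup M]
    [Module R M] [AddCommGroup P] [Module R P] (g : M →ₗ[R] P) (hg : Function.Surjective g)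
    (y : P) : Nat.card {x : M // g x = y} * Nat.card P = Nat.card M := by
  obtain ⟨x₀, rfl⟩ := hg y
  let e : {x : M // g x = g x₀} ≃ LinearMap.ker g :=
    (Equiv.subRight x₀).subtypeEquiv fun x => by simp [sub_eq_zero]
  rw [Nat.card_congr e, Submodule.card_eq_card_quotient_mul_card (LinearMap.ker g),
    Nat.card_congr (g.quotKerEquivOfSurjective hg).toEquiv, mul_comm]

/-- A code whose nonzero dual codewords all have weight greater than `T.card` projects onto all
of `F ^ T`. -/
theorem restrict_surjective_of_card_lt_dual_weight {ι F : Type*} [Fintype ι] [Field F]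
    [DecidableEq F] (C : Submodule F (ι → F)) (T : Finset ι)
    (hdual : ∀ u : ι → F, (∀ v ∈ C, ∑ i, u i * v i = 0) → u ≠ 0 → T.card < hammingNorm u) :
    Function.Surjective ((LinearMap.funLeft F F ((↑) : T → ι)).comp C.subtype) := by
  classical
  rw [← LinearMap.range_eq_top]
  by_contra h
  obtain ⟨φ, hφ, hφC⟩ := Submodule.exists_dual_map_eq_bot_of_lt_top (lt_top_iff_ne_top.2 h)
    inferInstance
  let u : ι → F := fun i => if hi : i ∈ T then φ (Pi.single ⟨i, hi⟩ 1) else 0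
  have hu (v : ι → F) : ∑ i, u i * v i = φ (LinearMap.funLeft F F ((↑) : T → ι) v) := by
    rw [φ.pi_apply_eq_sum_univ, ← Finset.sum_subset T.subset_univ, ← Finset.sum_coe_sort T]
    · refine Finset.sum_congr rfl fun i _ => ?_
      have hsingle : (fun j => if i = j then (1 : F) else 0) = Pi.single i 1 := by
        ext j
        simp [Pi.single_apply, eq_comm]
      simp [u, hsingle, LinearMap.funLeft_apply, mul_comm]
    · intro i _ hi
      simp [u, hi]
  refine (hdual u (fun v hv => ?_) fun hu0 => hφ ?_).not_ge ?_
  · rw [hu, ← Submodule.mem_bot F, ← hφC]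
    exact Submodule.mem_map_of_mem ⟨⟨v, hv⟩, rfl⟩
  · refine LinearMap.pi_ext' fun i => LinearMap.ext_ring ?_
    simpa [u] using congrFun hu0 i
  · refine Finset.card_le_card fun i hi => ?_
    by_contra hiT
    simp [u, hiT] at hi


/-- Delsarte's correspondence: if `C` is a linear code over a finite field `F` with
`|F| = d` such that every nonzero codeword of the dual code `C⊥` has Hamming weight
at least `m + 1` (with `m ≤ N`), then the array whose rows are the codewords of `C`
is an orthogonal array of strength `m`: for every set `T` of `m` coordinates and
every assignment `f`, exactly `|C| / d ^ m` codewords agree with `f` on `T`. -/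
theorem oa_of_dual_distance {N m : ℕ} (F : Type*) [Field F] [Fintype F] [DecidableEq F]
    (d : ℕ) (hd : Fintype.card F = d)
    (C : Submodule F (Fin N → F)) (hm : m ≤ N)
    (hdual : ∀ u : Fin N → F, (∀ v ∈ C, ∑ i, u i * v i = 0) → u ≠ 0 →
      m + 1 ≤ hammingNorm u) :
    ∀ T : Finset (Fin N), T.card = m → ∀ f : Fin N → F,
      Nat.card {c : Fin N → F // c ∈ C ∧ ∀ t ∈ T, c t = f t} = Nat.card C / d ^ m := by
  intro T hT f
  subst hd hT
  have hsurj := restrict_surjective_of_card_lt_dual_weight C T hdual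
  have hcard := LinearMap.card_fiber_mul_card_of_surjective _ hsurj fun t : T => f t
  let e : {c : Fin N → F // c ∈ C ∧ ∀ t ∈ T, c t = f t} ≃
      {c : C // ((LinearMap.funLeft F F ((↑) : T → Fin N)).comp C.subtype) c =
        fun t : T => f t} :=
    (Equiv.subtypeSubtypeEquivSubtypeInter _ _).symm.trans
      (Equiv.subtypeEquivRight fun c => by simp [funext_iff, LinearMap.funLeft_apply])
  rw [Nat.card_congr e, ← hcard, Nat.card_fun, Nat.card_eq_fintype_card (α := F),
    Nat.card_eq_fintype_card (α := T), Fintype.card_coe,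
    Nat.mul_div_cancel _ (pow_pos Fintype.card_pos _)]
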